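/- arXiv:1106.4855 — 2 statements merged into one kernel-verified Lean document; each statement's English description precedes it below -/
import Mathlib

section
/- Let T be a compact operator on a separable infinite-dimensional complex Hilbert space H. If T is a norm limit of complex symmetric operators, then T is itself a complex symmetric operator; that is, there exists a conjugation C on H with T = C T* C. -/
open Filter Topology ContinuousLinearMap

def IsConjugation {H : Type*} [NormedAddCommGroup H] [InnerProductSpace ℂ H]
    (C : H → H) : Prop :=
  (∀ x y, C (x + y) = C x + C y) ∧
  (∀ (a : ℂ) (x : H), C (a • x) = (starRingEnd ℂ a) • C x) ∧
  (∀ x, ‖C x‖ = ‖x‖) ∧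
  (∀ x, C (C x) = x)

def IsCSO {H : Type*} [NormedAddCommGroup H] [InnerProductSpace ℂ H]
    [CompleteSpace H] (T : H →L[ℂ] H) : Prop :=
  ∃ C : H → H, IsConjugation C ∧ ∀ x, T x = C (adjoint T (C x))

section Conjugation

variable {H : Type*} [NormedAddCommGroup H] [InnerProductSpace ℂ H]

namespace IsConjugation

variable {C : H → H}

lemma map_sub (hC : IsConjugation C) (x y : H) : C (x - y) = C x - C y := by
  have hneg : C (-y) = -C y := by simpa using hC.2.1 (-1) y
  rw [sub_eq_add_neg, hC.1, hneg, sub_eq_add_neg]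

lemma map_zero (hC : IsConjugation C) : C 0 = 0 := by
  simpa using hC.map_sub 0 0

lemma norm_sub (hC : IsConjugation C) (x y : H) : ‖C x - C y‖ = ‖x - y‖ := by
  rw [← hC.map_sub, hC.2.2.1]

end IsConjugation

lemma exists_isConjugation [CompleteSpace H] : ∃ C : H → H, IsConjugation C := by
  obtain ⟨w, b, -⟩ := exists_hilbertBasis ℂ H
  refine ⟨fun x => b.repr.symm (star (b.repr x)), fun x y => ?_, fun a x => ?_, fun x => ?_,
    fun x => ?_⟩
  · simp
  · simp [star_smul]
  · simp [norm_star]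
  · simp

/-- A conjugation of a subspace and one of its orthogonal complement add up to a conjugation. -/
lemma IsConjugation.exists_extension {M : Submodule ℂ H} [M.HasOrthogonalProjection]
    {c : M → M} (hc : IsConjugation c) {d : Mᗮ → Mᗮ} (hd : IsConjugation d) :
    ∃ C : H → H, IsConjugation C ∧ (∀ x : M, C x = c x) ∧ (∀ x : Mᗮ, C x = d x) := by
  set C : H → H := fun x =>
    (c (M.orthogonalProjectionOnto x) : H) + (d (Mᗮ.orthogonalProjectionOnto x) : H) with hCdef
  have hM : ∀ x : M, C x = c x := fun x => by
    have h : Mᗮ.orthogonalProjectionOnto (x : H) = 0 :=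
      Submodule.orthogonalProjectionOnto_apply_of_mem_orthogonal
        (M.le_orthogonal_orthogonal x.2)
    simp [hCdef, h, hd.map_zero]
  have hMp : ∀ x : Mᗮ, C x = d x := fun x => by
    have h : M.orthogonalProjectionOnto (x : H) = 0 :=
      Submodule.orthogonalProjectionOnto_apply_of_mem_orthogonal x.2
    simp [hCdef, h, hc.map_zero]
  have hadd : ∀ x y, C (x + y) = C x + C y := fun x y => by
    simp only [hCdef, _root_.map_add, hc.1, hd.1, Submodule.coe_add]
    abel
  refine ⟨C, ⟨hadd, fun a x => ?_, fun x => ?_, fun x => ?_⟩, hM, hMp⟩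
  · simp only [hCdef, _root_.map_smul, hc.2.1, hd.2.1, Submodule.coe_smul, smul_add]
  · rw [← sq_eq_sq₀ (norm_nonneg _) (norm_nonneg _), M.norm_sq_eq_add_norm_sq_projection x,
      ← hc.2.2.1, ← hd.2.2.1]
    simpa [sq] using norm_add_sq_eq_norm_sq_add_norm_sq_of_inner_eq_zero _ _
      (M.inner_right_of_mem_orthogonal (c (M.orthogonalProjectionOnto x)).2
        (d (Mᗮ.orthogonalProjectionOnto x)).2)
  · change C ((c (M.orthogonalProjectionOnto x) : H) + d (Mᗮ.orthogonalProjectionOnto x)) = x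
    rw [hadd, hM, hMp, hc.2.2.2, hd.2.2.2]
    exact M.starProjection_add_starProjection_orthogonal x

variable {ι : Type*} {C : ι → H → H} {l : Filter ι}

/-- The subspace of vectors on which a family of conjugations converges along a filter. -/
def convergenceSubspace (hC : ∀ n, IsConjugation (C n)) (l : Filter ι) : Submodule ℂ H where
  carrier := {x | ∃ y, Tendsto (fun n => C n x) l (𝓝 y)}
  add_mem' := by
    rintro x y ⟨x', hx⟩ ⟨y', hy⟩
    exact ⟨x' + y', by simpa only [(hC _).1] using hx.add hy⟩
  zero_mem' := ⟨0, by simpa only [(hC _).map_zero] using tendsto_const_nhds⟩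
  smul_mem' := by
    rintro a x ⟨x', hx⟩
    exact ⟨starRingEnd ℂ a • x', by simpa only [(hC _).2.1] using hx.const_smul _⟩

lemma isClosed_convergenceSubspace [CompleteSpace H] [l.NeBot]
    (hC : ∀ n, IsConjugation (C n)) :
    IsClosed (convergenceSubspace hC l : Set H) := by
  refine isClosed_of_closure_subset fun x hx => ?_
  refine cauchy_map_iff_exists_tendsto.1 (Metric.cauchy_iff.2 ⟨inferInstance, fun ε hε => ?_⟩)
  obtain ⟨y, ⟨y', hy⟩, hxy⟩ := Metric.mem_closure_iff.1 hx (ε / 4) (by positivity)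
  refine ⟨Metric.ball y' (ε / 2), ?_, fun a ha b hb => ?_⟩
  · rw [mem_map]
    filter_upwards [Metric.tendsto_nhds.1 hy (ε / 4) (by positivity)] with n hn
    have h1 : dist (C n x) (C n y) = dist x y := by
      rw [dist_eq_norm, dist_eq_norm, (hC n).norm_sub]
    have h2 := dist_triangle (C n x) (C n y) y'
    simp only [Set.mem_preimage, Metric.mem_ball]
    linarith
  · have := dist_triangle_right a b y'
    simp only [Metric.mem_ball] at ha hb
    linarith

/-- The pointwise limit of conjugations is a conjugation of the subspace where it exists. -/
lemma exists_isConjugation_tendsto [l.NeBot] (hC : ∀ n, IsConjugation (C n)) :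
    ∃ c : convergenceSubspace hC l → convergenceSubspace hC l, IsConjugation c ∧
      ∀ x : convergenceSubspace hC l, Tendsto (fun n => C n (x : H)) l (𝓝 (c x : H)) := by
  have inv : ∀ x y : H, Tendsto (fun n => C n x) l (𝓝 y) →
      Tendsto (fun n => C n y) l (𝓝 x) := fun x y h => by
    rw [tendsto_iff_norm_sub_tendsto_zero] at h ⊢
    refine h.congr fun n => ?_
    rw [← (hC n).norm_sub, (hC n).2.2.2, norm_sub_rev]
  have hex : ∀ x : convergenceSubspace hC l, ∃ y : convergenceSubspace hC l,
      Tendsto (fun n => C n (x : H)) l (𝓝 (y : H)) := fun x => by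
    obtain ⟨y, hy⟩ := x.2
    exact ⟨⟨y, x, inv _ _ hy⟩, hy⟩
  choose c hc using hex
  refine ⟨c, ⟨fun x y => ?_, fun a x => ?_, fun x => ?_, fun x => ?_⟩, hc⟩
  · refine Subtype.ext (tendsto_nhds_unique (hc (x + y)) ?_)
    simpa only [Submodule.coe_add, (hC _).1] using (hc x).add (hc y)
  · refine Subtype.ext (tendsto_nhds_unique (hc (a • x)) ?_)
    simpa only [Submodule.coe_smul, (hC _).2.1] using (hc x).const_smul (starRingEnd ℂ a)
  · refine tendsto_nhds_unique (hc x).norm ?_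
    simp only [(hC _).2.2.1]
    exact tendsto_const_nhds
  · exact Subtype.ext (tendsto_nhds_unique (hc (c x)) (inv _ _ (hc x)))

end Conjugation

section Limit

variable {H : Type*} [NormedAddCommGroup H] [InnerProductSpace ℂ H]
  {ι : Type*} {l : Filter ι} {C : ι → H → H} {A B : ι → H →L[ℂ] H} {a b : H →L[ℂ] H}

/-- An intertwining relation `C n (A n x) = B n (C n x)` holds asymptotically for the limits. -/
lemma tendsto_conjugation_sub (hC : ∀ n, IsConjugation (C n))
    (hA : Tendsto A l (𝓝 a)) (hB : Tendsto B l (𝓝 b))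
    (hAB : ∀ n x, C n (A n x) = B n (C n x)) (x : H) :
    Tendsto (fun n => C n (a x) - b (C n x)) l (𝓝 0) := by
  have h1 := (tendsto_iff_norm_sub_tendsto_zero.1 hA).mul_const ‖x‖
  have h2 := (tendsto_iff_norm_sub_tendsto_zero.1 hB).mul_const ‖x‖
  refine squeeze_zero_norm (fun n => ?_) (by simpa using h1.add h2)
  have e : C n (a x) - b (C n x) = (C n (a x) - C n (A n x)) + (B n - b) (C n x) := by
    rw [hAB, _root_.sub_apply]
    abel
  rw [e]
  refine (norm_add_le _ _).trans (add_le_add ?_ ?_)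
  · rw [(hC n).norm_sub, norm_sub_rev]
    exact (A n - a).le_opNorm x
  · simpa only [(hC n).2.2.1] using (B n - b).le_opNorm (C n x)

end Limit

/-- Every compact operator that is a norm limit of complex symmetric operators
is itself complex symmetric. -/
theorem compact_norm_limit_CSO_is_CSO {H : Type*} [NormedAddCommGroup H]
    [InnerProductSpace ℂ H] [CompleteSpace H]
    [TopologicalSpace.SeparableSpace H] (hinf : ¬ FiniteDimensional ℂ H)
    (T : H →L[ℂ] H) (hcompact : IsCompactOperator T)
    (hlim : ∃ Tseq : ℕ → (H →L[ℂ] H), (∀ n, IsCSO (Tseq n)) ∧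
      Tendsto Tseq atTop (𝓝 T)) :
    IsCSO T := by
  obtain ⟨S, hS, hST⟩ := hlim
  choose C hC hCS using hS
  let U : Ultrafilter ℕ := Ultrafilter.of atTop
  have hSU : Tendsto S U (𝓝 T) := hST.mono_left (Ultrafilter.of_le _)
  have hSU' : Tendsto (fun n => adjoint (S n)) U (𝓝 (adjoint T)) :=
    ((adjoint (𝕜 := ℂ) (E := H) (F := H)).continuous.tendsto T).comp hSU
  have key : ∀ x, Tendsto (fun n => C n (T x) - adjoint T (C n x)) U (𝓝 0) :=
    tendsto_conjugation_sub hC hSU hSU' fun n x => by rw [hCS n x, (hC n).2.2.2]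
  have key' : ∀ x, Tendsto (fun n => C n (adjoint T x) - T (C n x)) U (𝓝 0) :=
    tendsto_conjugation_sub hC hSU' hSU fun n x => by rw [hCS n (C n x), (hC n).2.2.2]
  set M := convergenceSubspace hC (U : Filter ℕ)
  have : CompleteSpace M := (isClosed_convergenceSubspace hC).completeSpace_coe
  have adjoint_mem : ∀ x, adjoint T x ∈ M := fun x => by
    obtain ⟨K, hK, hTK⟩ := hcompact.image_closedBall_subset_compact (f := (T : H →ₗ[ℂ] H)) ‖x‖
    obtain ⟨y, -, hy⟩ := hK.ultrafilter_le_nhds (U.map fun n : ℕ => T (C n x))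
      (le_principal_iff.2 <| mem_map.2 <| Eventually.of_forall fun n =>
        hTK ⟨C n x, by simp [(hC n).2.2.1], rfl⟩)
    have hy' : Tendsto (fun n => T (C n x)) U (𝓝 y) := hy
    exact ⟨0 + y, by simpa using (key' x).add hy'⟩
  obtain ⟨c, hc, hct⟩ := exists_isConjugation_tendsto (l := (U : Filter ℕ)) hC
  have tendsto_T : ∀ m : M, Tendsto (fun n => C n (T m)) U (𝓝 (adjoint T (c m))) := fun m => by
    simpa using (key m).add (((adjoint T).continuous.tendsto _).comp (hct m))
  have T_perp : ∀ q : Mᗮ, T q = 0 := fun q => ext_inner_left ℂ fun v => by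
    rw [← adjoint_inner_left, inner_zero_right]
    exact M.inner_right_of_mem_orthogonal (adjoint_mem v) q.2
  have decomp : ∀ x : H, ∃ (m : M) (q : Mᗮ), x = m + q := fun x =>
    ⟨M.orthogonalProjectionOnto x, Mᗮ.orthogonalProjectionOnto x,
      (M.starProjection_add_starProjection_orthogonal x).symm⟩
  have T_mem : ∀ x, T x ∈ M := fun x => by
    obtain ⟨m, q, rfl⟩ := decomp x
    rw [map_add, T_perp, add_zero]
    exact ⟨_, tendsto_T m⟩
  have adjoint_perp : ∀ q : Mᗮ, adjoint T q = 0 := fun q => ext_inner_left ℂ fun v => by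
    rw [adjoint_inner_right, inner_zero_right]
    exact M.inner_right_of_mem_orthogonal (T_mem v) q.2
  obtain ⟨d, hd⟩ := exists_isConjugation (H := Mᗮ)
  obtain ⟨D, hD, hDc, hDd⟩ := hc.exists_extension hd
  refine ⟨D, hD, fun x => ?_⟩
  obtain ⟨m, q, rfl⟩ := decomp x
  have hm : D (T m) = adjoint T (c m) :=
    (hDc ⟨T m, T_mem m⟩).trans (tendsto_nhds_unique (hct ⟨T m, T_mem m⟩) (tendsto_T m))
  rw [map_add, T_perp, add_zero, hD.1, hDc, hDd, map_add, adjoint_perp, add_zero, ← hm, hD.2.2.2]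
end

section
/- Let T be an irreducible weighted shift (weights α_n > 0) that is a norm limit of complex symmetric operators, and set α₊ = sup_n α_n. Then there exists a subsequence of (α_n) converging to α₊. -/
open Filter Topology ContinuousLinearMap

noncomputable section

abbrev L2 : Type := lp (fun _ : ℕ => ℂ) 2

def e (n : ℕ) : L2 := lp.single 2 n 1

theorem norm_e (n : ℕ) : ‖e n‖ = 1 := by
  simp [e, lp.norm_single]

theorem inner_e (n : ℕ) (x : L2) : inner ℂ (e n) x = x n := by
  simp [e, lp.inner_single_left]

theorem adjoint_weightedShift_apply {α : ℕ → ℝ} {T : L2 →L[ℂ] L2}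
    (hT : ∀ n, T (e n) = (α n : ℂ) • e (n + 1)) (x : L2) (m : ℕ) :
    (adjoint T x) m = (α m : ℂ) * x (m + 1) := by
  rw [← inner_e, adjoint_inner_right, hT, inner_smul_left, inner_e]
  simp

theorem norm_adjoint_weightedShift_pow_apply_le {α : ℕ → ℝ} (hα : ∀ n, 0 < α n) {A : ℝ}
    (hA : ∀ n, α n ≤ A) {T : L2 →L[ℂ] L2}
    (hT : ∀ n, T (e n) = (α n : ℂ) • e (n + 1)) (j : ℕ) (x : L2) (m : ℕ) :
    ‖((adjoint T ^ j) x) m‖ ≤ A ^ j * ‖x (m + j)‖ := by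
  induction j generalizing x with
  | zero => simp
  | succ j ih =>
    rw [pow_succ, mul_def, comp_apply]
    refine (ih _).trans ?_
    have hA0 : 0 ≤ A := (hα 0).le.trans (hA 0)
    rw [adjoint_weightedShift_apply hT, norm_mul, Complex.norm_real,
      Real.norm_of_nonneg (hα _).le, pow_succ, mul_assoc, add_assoc]
    gcongr
    exact hA _

theorem norm_weightedShift_pow_apply_pos {α : ℕ → ℝ} (hα : ∀ n, 0 < α n) {T : L2 →L[ℂ] L2}
    (hT : ∀ n, T (e n) = (α n : ℂ) • e (n + 1)) (j n : ℕ) :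
    0 < ‖(T ^ j) (e n)‖ := by
  induction j generalizing n with
  | zero => simp [norm_e]
  | succ j ih =>
    rw [pow_succ, mul_def, comp_apply, hT, map_smul, norm_smul]
    exact mul_pos (norm_pos_iff.mpr (Complex.ofReal_ne_zero.mpr (hα n).ne')) (ih (n + 1))

theorem hasSum_norm_sq (x : L2) : HasSum (fun i => ‖x i‖ ^ 2) (‖x‖ ^ 2) := by
  have h := lp.hasSum_norm (p := 2) (by norm_num) x
  simpa using h

/-- If all but the first `N` weights are at most `β`, then a vector on which the adjoint of the
shift almost attains the bound `A` is almost annihilated by a high power of that adjoint. -/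
theorem norm_adjoint_weightedShift_pow_sq_le {α : ℕ → ℝ} (hα : ∀ n, 0 < α n) {A β : ℝ}
    (hA : ∀ n, α n ≤ A) {N : ℕ} (hβ : ∀ n, N ≤ n → α n ≤ β) (hβA : β ≤ A) {T : L2 →L[ℂ] L2}
    (hT : ∀ n, T (e n) = (α n : ℂ) • e (n + 1)) (x : L2) :
    (A ^ 2 - β ^ 2) * ‖(adjoint T ^ (N + 1)) x‖ ^ 2 ≤
      (A ^ (N + 1)) ^ 2 * (A ^ 2 * ‖x‖ ^ 2 - ‖adjoint T x‖ ^ 2) := by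
  have hβ0 : 0 < β := (hα N).trans_le (hβ N le_rfl)
  have hx := hasSum_norm_sq x
  have hS := hasSum_norm_sq (adjoint T x)
  have hj := hasSum_norm_sq ((adjoint T ^ (N + 1)) x)
  have hx1 : HasSum (fun i => ‖x (i + 1)‖ ^ 2) (‖x‖ ^ 2 - ‖x 0‖ ^ 2) := by
    simpa using (hasSum_nat_add_iff' 1).mpr hx
  have hD := (hx1.mul_left (A ^ 2)).sub hS
  have hterm : ∀ i, A ^ 2 * ‖x (i + 1)‖ ^ 2 - ‖(adjoint T x) i‖ ^ 2 =
      (A ^ 2 - α i ^ 2) * ‖x (i + 1)‖ ^ 2 := by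
    intro i
    rw [adjoint_weightedShift_apply hT, norm_mul, Complex.norm_real,
      Real.norm_of_nonneg (hα _).le]
    ring
  have hnonneg : ∀ i, 0 ≤ A ^ 2 * ‖x (i + 1)‖ ^ 2 - ‖(adjoint T x) i‖ ^ 2 := by
    intro i
    rw [hterm]
    have := pow_le_pow_left₀ (hα i).le (hA i) 2
    exact mul_nonneg (by linarith) (by positivity)
  have hDN := (hasSum_nat_add_iff' N).mpr hD
  have hle := hasSum_le (fun i => ?_) (hj.mul_left (A ^ 2 - β ^ 2))
    (hDN.mul_left ((A ^ (N + 1)) ^ 2))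
  · refine hle.trans ?_
    refine mul_le_mul_of_nonneg_left ?_ (by positivity)
    have := Finset.sum_nonneg fun i (_ : i ∈ Finset.range N) => hnonneg i
    nlinarith [mul_nonneg (sq_nonneg A) (sq_nonneg ‖x 0‖)]
  · rw [hterm]
    have h1 := norm_adjoint_weightedShift_pow_apply_le hα hA hT (N + 1) x i
    have h2 := pow_le_pow_left₀ (norm_nonneg _) h1 2
    have h3 := pow_le_pow_left₀ (hα (i + N)).le (hβ (i + N) (by omega)) 2
    have h4 := pow_le_pow_left₀ hβ0.le hβA 2
    calc (A ^ 2 - β ^ 2) * ‖((adjoint T ^ (N + 1)) x) i‖ ^ 2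
        ≤ (A ^ 2 - β ^ 2) * (A ^ (N + 1) * ‖x (i + (N + 1))‖) ^ 2 :=
          mul_le_mul_of_nonneg_left h2 (by linarith)
      _ = (A ^ (N + 1)) ^ 2 * ((A ^ 2 - β ^ 2) * ‖x (i + N + 1)‖ ^ 2) := by
          rw [← add_assoc]; ring
      _ ≤ _ := by gcongr

section ComplexSymmetric

variable {H : Type*} [NormedAddCommGroup H] [InnerProductSpace ℂ H] [CompleteSpace H]

theorem adjoint_pow_conjugation_apply {T : H →L[ℂ] H} {C : H → H} (hC : IsConjugation C)
    (hT : ∀ x, T x = C (adjoint T (C x))) (j : ℕ) (x : H) :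
    (adjoint T ^ j) (C x) = C ((T ^ j) x) := by
  induction j generalizing x with
  | zero => simp
  | succ j ih =>
    rw [pow_succ, mul_def, comp_apply, pow_succ, mul_def, comp_apply, ← ih, hT x, hC.2.2.2]

theorem tendsto_norm_adjoint_pow_conjugation {T : H →L[ℂ] H} {Tseq : ℕ → (H →L[ℂ] H)}
    (hlim : Tendsto Tseq atTop (𝓝 T)) {C : ℕ → H → H} (hC : ∀ k, IsConjugation (C k))
    (hT : ∀ k x, Tseq k x = C k (adjoint (Tseq k) (C k x))) (j : ℕ) (x : H) :
    Tendsto (fun k => ‖(adjoint T ^ j) (C k x)‖) atTop (𝓝 ‖(T ^ j) x‖) := by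
  have hadj : Tendsto (fun k => adjoint (Tseq k) ^ j) atTop (𝓝 (adjoint T ^ j)) :=
    (((adjoint (𝕜 := ℂ) (E := H) (F := H)).continuous.tendsto T).comp hlim).pow j
  have h1 : Tendsto (fun k => ‖(Tseq k ^ j) x‖) atTop (𝓝 ‖(T ^ j) x‖) :=
    (((apply ℂ H x).continuous.tendsto (T ^ j)).comp (hlim.pow j)).norm
  have h2 : Tendsto (fun k => ‖adjoint T ^ j - adjoint (Tseq k) ^ j‖ * ‖x‖) atTop (𝓝 0) := by
    simpa using (((tendsto_const_nhds (x := adjoint T ^ j)).sub hadj).norm.mul_const ‖x‖)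
  have h3 : Tendsto (fun k => ‖(adjoint T ^ j) (C k x)‖ - ‖(Tseq k ^ j) x‖) atTop (𝓝 0) := by
    refine squeeze_zero_norm (fun k => ?_) h2
    rw [← (hC k).2.2.1 ((Tseq k ^ j) x), ← adjoint_pow_conjugation_apply (hC k) (hT k)]
    refine (abs_norm_sub_norm_le _ _).trans ?_
    rw [← sub_apply, ← (hC k).2.2.1 x]
    exact le_opNorm _ _
  simpa using h3.add h1

end ComplexSymmetric

theorem exists_eq_iSup_of_eventually_le {α : ℕ → ℝ} (hbdd : BddAbove (Set.range α)) {β : ℝ}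
    (hβ : β < ⨆ n, α n) {N : ℕ} (hN : ∀ n, N ≤ n → α n ≤ β) : ∃ n, α n = ⨆ n, α n := by
  obtain ⟨m, hm⟩ := exists_lt_of_lt_ciSup hβ
  have hmN : m < N := by
    by_contra! h
    exact (hN m h).not_gt hm
  obtain ⟨n, -, hn⟩ := Finset.exists_max_image (Finset.range N) α ⟨m, by simpa using hmN⟩
  refine ⟨n, le_antisymm (le_ciSup hbdd n) (ciSup_le fun i => ?_)⟩
  rcases lt_or_ge i N with h | h
  · exact hn i (by simpa using h)
  · exact (hN i h).trans (hm.le.trans (hn m (by simpa using hmN)))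

/-- If an irreducible weighted shift with bounded weights is a norm limit of
complex symmetric operators, some subsequence of its weights converges to
`α₊ = sup α_n`. -/
theorem weights_subseq_to_sup (α : ℕ → ℝ) (hα : ∀ n, 0 < α n)
    (hbdd : BddAbove (Set.range α))
    (T : L2 →L[ℂ] L2) (hT : ∀ n, T (e n) = (α n : ℂ) • e (n + 1))
    (hlim : ∃ Tseq : ℕ → (L2 →L[ℂ] L2), (∀ n, IsCSO (Tseq n)) ∧
      Tendsto Tseq atTop (𝓝 T)) :
    ∃ φ : ℕ → ℕ, StrictMono φ ∧
      Tendsto (fun k => α (φ k)) atTop (𝓝 (⨆ n, α n)) := by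
  obtain ⟨Tseq, hcso, hlim⟩ := hlim
  choose C hC hTC using hcso
  set A := ⨆ n, α n with hAdef
  have hA : ∀ n, α n ≤ A := le_ciSup hbdd
  refine MapClusterPt.tendsto_subseq ?_
  rw [mapClusterPt_iff_frequently]
  intro s hs
  by_contra hfreq
  obtain ⟨N, hN⟩ := eventually_atTop.mp (not_frequently.mp hfreq)
  obtain ⟨ε, hε, hball⟩ := Metric.mem_nhds_iff.mp hs
  have hβ : ∀ n, N ≤ n → α n ≤ A - ε := by
    intro n hn
    by_contra! h
    refine hN n hn (hball ?_)
    rw [Metric.mem_ball, Real.dist_eq, abs_lt]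
    constructor <;> linarith [hA n]
  obtain ⟨n, hn⟩ := exists_eq_iSup_of_eventually_le hbdd (sub_lt_self A hε) hβ
  have h1 := tendsto_norm_adjoint_pow_conjugation hlim hC hTC 1 (e n)
  have h2 := tendsto_norm_adjoint_pow_conjugation hlim hC hTC (N + 1) (e n)
  have hTn : ‖T (e n)‖ = A := by
    rw [hT, norm_smul, norm_e, Complex.norm_real, Real.norm_of_nonneg (hα n).le, mul_one, hn]
  simp only [pow_one, hTn] at h1
  have hle := le_of_tendsto_of_tendsto' ((h2.pow 2).const_mul (A ^ 2 - (A - ε) ^ 2))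
    (((h1.pow 2).const_sub (A ^ 2)).const_mul ((A ^ (N + 1)) ^ 2)) fun k => by
      simpa [(hC k).2.2.1, norm_e] using norm_adjoint_weightedShift_pow_sq_le hα hA hβ
        (sub_le_self A hε.le) hT (C k (e n))
  rw [sub_self, mul_zero] at hle
  have hpos := norm_weightedShift_pow_apply_pos hα hT (N + 1) n
  have hβ0 : 0 < A - ε := (hα N).trans_le (hβ N le_rfl)
  have hgap : 0 < A ^ 2 - (A - ε) ^ 2 := by nlinarith
  exact hle.not_gt (by positivity)
end
end
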